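/- arXiv:2105.03038 — 4 statements merged into one kernel-verified Lean document; each statement's English description precedes it below -/
import Mathlib

section
/- A preordered monoid is a pregroup if and only if it satisfies both Frobenius conditions (F1) and (F2). (This is the representable form of Theorem 1: pregroups are exactly the pointed spiders.) -/
/-- A preordered monoid (monoid with a preorder in which multiplication is
monotone in both arguments) is a pregroup (every element has a left adjoint
and a right adjoint) iff it satisfies both Frobenius conditions (F1) and (F2). -/
theorem pregroup_iff_frobenius {M : Type*} [Monoid M] [Preorder M]
    (hmul : ∀ a b c d : M, a ≤ b → c ≤ d → a * c ≤ b * d) :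
    ((∀ x : M, ∃ s : M, x * s ≤ 1 ∧ 1 ≤ s * x) ∧
     (∀ x : M, ∃ t : M, t * x ≤ 1 ∧ 1 ≤ x * t)) ↔
    ((∀ x y u v : M, x * y ≤ u * v → ∃ s : M, x * s ≤ u ∧ y ≤ s * v) ∧
     (∀ x y u v : M, x * y ≤ u * v → ∃ t : M, x ≤ u * t ∧ t * y ≤ v)) := by
  constructor
  · rintro ⟨hl, hr⟩
    refine ⟨fun x y u v h => ?_, fun x y u v h => ?_⟩
    · obtain ⟨l, h1, h2⟩ := hl v
      refine ⟨y * l, ?_, ?_⟩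
      · have a := hmul _ _ l l h le_rfl
        have b := hmul u u _ _ le_rfl h1
        rw [mul_one, ← mul_assoc] at b
        rw [← mul_assoc]
        exact a.trans b
      · have b := hmul y y _ _ le_rfl h2
        rwa [mul_one, ← mul_assoc] at b
    · obtain ⟨r, h1, h2⟩ := hr u
      refine ⟨r * x, ?_, ?_⟩
      · have b := hmul _ _ x x h2 le_rfl
        rwa [one_mul, mul_assoc] at b
      · have a := hmul r r _ _ le_rfl h
        have b := hmul _ _ v v h1 le_rfl
        rw [one_mul, mul_assoc] at b
        rw [mul_assoc]
        exact a.trans b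
  · rintro ⟨h1, h2⟩
    refine ⟨fun x => h1 x 1 1 x (by simp), fun x => ?_⟩
    obtain ⟨t, a, b⟩ := h2 1 x x 1 (by simp)
    exact ⟨t, b, a⟩
end

section
/- In a preordered monoid in which every element x has a left adjoint (an element s with x*s ≤ 1 ≤ s*x), the first Frobenius condition holds: for all x, y, u, v, if x*y ≤ u*v then there exists s with x*s ≤ u and y ≤ s*v. -/
/-- In a preordered monoid in which every element has a left adjoint,
the first Frobenius condition (F1) holds. -/
theorem frobenius_one_of_leftAdjoints {M : Type*} [Monoid M] [Preorder M]
    (hmul : ∀ a b c d : M, a ≤ b → c ≤ d → a * c ≤ b * d)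
    (hladj : ∀ x : M, ∃ s : M, x * s ≤ 1 ∧ 1 ≤ s * x) :
    ∀ x y u v : M, x * y ≤ u * v → ∃ s : M, x * s ≤ u ∧ y ≤ s * v := by
  intro x y u v h
  obtain ⟨l, h1, h2⟩ := hladj x
  refine ⟨l * u, ?_, ?_⟩
  · have := hmul _ _ _ _ h1 (le_refl u)
    rwa [one_mul, mul_assoc] at this
  · have a := hmul _ _ _ _ h2 (le_refl y)
    have b := hmul _ _ _ _ (le_refl l) h
    rw [one_mul, mul_assoc] at a
    rw [mul_assoc]
    exact a.trans b
end

section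
/- In a preordered monoid in which every element x has a right adjoint (an element t with t*x ≤ 1 ≤ x*t), the second Frobenius condition holds: for all x, y, u, v, if x*y ≤ u*v then there exists t with x ≤ u*t and t*y ≤ v. -/
/-- In a preordered monoid in which every element has a right adjoint,
the second Frobenius condition (F2) holds. -/
theorem frobenius_two_of_rightAdjoints {M : Type*} [Monoid M] [Preorder M]
    (hmul : ∀ a b c d : M, a ≤ b → c ≤ d → a * c ≤ b * d)
    (hradj : ∀ x : M, ∃ t : M, t * x ≤ 1 ∧ 1 ≤ x * t) :
    ∀ x y u v : M, x * y ≤ u * v → ∃ t : M, x ≤ u * t ∧ t * y ≤ v := by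
  intro x y u v h
  obtain ⟨s, h1, h2⟩ := hradj u
  refine ⟨s * x, ?_, ?_⟩
  · have := hmul _ _ _ _ h2 (le_refl x)
    rwa [one_mul, mul_assoc] at this
  · have a := hmul _ _ _ _ (le_refl s) h
    have b := hmul _ _ _ _ h1 (le_refl v)
    rw [one_mul, mul_assoc] at b
    rw [mul_assoc]
    exact a.trans b
end

section
/- A preordered monoid satisfying both Frobenius conditions (F1) and (F2) is residuated: for all x and b there exists r such that for all a, x*a ≤ b if and only if a ≤ r; and for all x and b there exists r' such that for all a, a*x ≤ b if and only if a ≤ r'. (Representable instance of Theorem 2: Frobenius algebras are residuated monoids.) -/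
/-- A preordered monoid satisfying both Frobenius conditions is residuated. -/
theorem residuated_of_frobenius {M : Type*} [Monoid M] [Preorder M]
    (hmul : ∀ a b c d : M, a ≤ b → c ≤ d → a * c ≤ b * d)
    (hF1 : ∀ x y u v : M, x * y ≤ u * v → ∃ s : M, x * s ≤ u ∧ y ≤ s * v)
    (hF2 : ∀ x y u v : M, x * y ≤ u * v → ∃ t : M, x ≤ u * t ∧ t * y ≤ v) :
    (∀ x b : M, ∃ r : M, ∀ a : M, x * a ≤ b ↔ a ≤ r) ∧
    (∀ x b : M, ∃ r' : M, ∀ a : M, a * x ≤ b ↔ a ≤ r') := by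
  constructor
  · intro x b
    obtain ⟨s, h1, h2⟩ := hF1 x 1 1 x (by simp)
    refine ⟨s * b, fun a => ⟨fun h => ?_, fun h => ?_⟩⟩
    · have e1 := hmul _ _ _ _ h2 (le_refl a)
      have e2 := hmul _ _ _ _ (le_refl s) h
      rw [one_mul, mul_assoc] at e1
      exact e1.trans e2
    · have e1 := hmul _ _ _ _ (le_refl x) h
      have e2 := hmul _ _ _ _ h1 (le_refl b)
      rw [one_mul, mul_assoc] at e2
      exact e1.trans e2
  · intro x b
    obtain ⟨t, h1, h2⟩ := hF2 1 x x 1 (by simp)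
    refine ⟨b * t, fun a => ⟨fun h => ?_, fun h => ?_⟩⟩
    · have e1 := hmul _ _ _ _ (le_refl a) h1
      have e2 := hmul _ _ _ _ h (le_refl t)
      rw [mul_one, ← mul_assoc] at e1
      exact e1.trans e2
    · have e1 := hmul _ _ _ _ h (le_refl x)
      have e2 := hmul _ _ _ _ (le_refl b) h2
      rw [mul_one, ← mul_assoc] at e2
      exact e1.trans e2
end
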